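/- Let M be an ergodic row-stochastic matrix on a finite state space Ω, let κ̃ be its generalized contraction coefficient, and let ξ ∈ (0,1/2). Then the mixing time satisfies t_mix(ξ) ≥ (1 − 2ξ)/(1 − κ̃). -/

import Mathlib

variable {Ω : Type*} [Fintype Ω] [DecidableEq Ω] [Nonempty Ω]

/-- A probability distribution on `Ω`. -/
def IsDist (f : Ω → ℝ) : Prop := (∀ x, 0 ≤ f x) ∧ ∑ x, f x = 1

/-- A row-stochastic (Markov) matrix. -/
def IsStochastic (M : Matrix Ω Ω ℝ) : Prop :=
  (∀ i j, 0 ≤ M i j) ∧ ∀ i, ∑ j, M i j = 1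

/-- Ergodicity: some power of `M` is entrywise positive. -/
def IsErgodic (M : Matrix Ω Ω ℝ) : Prop := ∃ p : ℕ, 0 < p ∧ ∀ i j, 0 < (M ^ p) i j

/-- Total variation distance between two distributions on `Ω`. -/
noncomputable def tvDist (μ ν : Ω → ℝ) : ℝ := (1 / 2) * ∑ x, |μ x - ν x|

/-- Dobrushin contraction coefficient `κ(M) = max_{i,j} ‖M(i,·) − M(j,·)‖_TV`. -/
noncomputable def dobrushin (M : Matrix Ω Ω ℝ) : ℝ :=
  Finset.univ.sup' Finset.univ_nonempty fun p : Ω × Ω => tvDist (M p.1) (M p.2)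

/-- Generalized contraction coefficient `κ̃ = 1 − sup_{s ≥ 1} (1 − κ(M^s))/s`. -/
noncomputable def genCC (M : Matrix Ω Ω ℝ) : ℝ :=
  1 - ⨆ s : {n : ℕ // 0 < n}, (1 - dobrushin (M ^ (s : ℕ))) / ((s : ℕ) : ℝ)

/-- Distance to stationarity `h(t) = sup_{μ ∈ Δ_Ω} ‖μ M^t − π‖_TV`. -/
noncomputable def distToStat (M : Matrix Ω Ω ℝ) (π : Ω → ℝ) (t : ℕ) : ℝ :=
  ⨆ μ : {f : Ω → ℝ // IsDist f}, tvDist (Matrix.vecMul μ.1 (M ^ t)) π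

/-- Mixing time `t_mix(ξ) = min{t ∈ ℕ : h(t) < ξ}` (with `ℕ = {1,2,…}`). -/
noncomputable def mixTime (M : Matrix Ω Ω ℝ) (π : Ω → ℝ) (ξ : ℝ) : ℕ :=
  sInf {t : ℕ | 0 < t ∧ distToStat M π t < ξ}

open Matrix in
/-- Minorization contracts the `ℓ¹` norm of a vector of zero total mass. -/
theorem IsStochastic.sum_abs_vecMul_le {Ω : Type*} [Fintype Ω] {A : Matrix Ω Ω ℝ}
    (hA : IsStochastic A) {δ : ℝ} (hδ : ∀ i j, δ ≤ A i j) {v : Ω → ℝ} (hv : ∑ x, v x = 0) :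
    ∑ x, |(v ᵥ* A) x| ≤ (1 - Fintype.card Ω * δ) * ∑ x, |v x| := by
  have key : ∀ j, |(v ᵥ* A) j| ≤ ∑ i, |v i| * (A i j - δ) := fun j => by
    have h : (v ᵥ* A) j = ∑ i, v i * (A i j - δ) := by
      simp [Matrix.vecMul, dotProduct, mul_sub, Finset.sum_sub_distrib, ← Finset.sum_mul, hv]
    rw [h]
    refine (Finset.abs_sum_le_sum_abs _ _).trans_eq (Finset.sum_congr rfl fun i _ => ?_)
    rw [abs_mul, abs_of_nonneg (sub_nonneg.2 (hδ i j))]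
  refine (Finset.sum_le_sum fun j _ => key j).trans_eq ?_
  rw [Finset.sum_comm, Finset.mul_sum]
  refine Finset.sum_congr rfl fun i _ => ?_
  rw [← Finset.mul_sum, Finset.sum_sub_distrib, hA.2 i]
  simp [mul_comm]

open Matrix in
theorem IsStochastic.sum_vecMul {Ω : Type*} [Fintype Ω] {A : Matrix Ω Ω ℝ}
    (hA : IsStochastic A) (v : Ω → ℝ) : ∑ x, (v ᵥ* A) x = ∑ x, v x := by
  simp only [Matrix.vecMul, dotProduct]
  rw [Finset.sum_comm]
  simp [← Finset.mul_sum, hA.2]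

theorem IsStochastic.pow {Ω : Type*} [Fintype Ω] [DecidableEq Ω] {A : Matrix Ω Ω ℝ}
    (hA : IsStochastic A) (n : ℕ) : IsStochastic (A ^ n) := by
  induction n with
  | zero =>
    refine ⟨fun i j => ?_, fun i => by simp [Matrix.one_apply]⟩
    by_cases h : i = j <;> simp [h]
  | succ n ih =>
    refine ⟨fun i j => ?_, fun i => ?_⟩
    · rw [pow_succ, Matrix.mul_apply]
      exact Finset.sum_nonneg fun k _ => mul_nonneg (ih.1 i k) (hA.1 k j)
    · rw [pow_succ]
      exact (hA.sum_vecMul ((A ^ n) i)).trans (ih.2 i)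

open Matrix in
theorem IsStochastic.sum_abs_vecMul_pow_le {Ω : Type*} [Fintype Ω] [DecidableEq Ω]
    {A : Matrix Ω Ω ℝ} (hA : IsStochastic A) {δ : ℝ} (hδ : ∀ i j, δ ≤ A i j)
    (hc : 0 ≤ 1 - Fintype.card Ω * δ) {v : Ω → ℝ} (hv : ∑ x, v x = 0) (n : ℕ) :
    ∑ x, |(v ᵥ* A ^ n) x| ≤ (1 - Fintype.card Ω * δ) ^ n * ∑ x, |v x| := by
  induction n with
  | zero => simp
  | succ n ih =>
    rw [pow_succ A, ← Matrix.vecMul_vecMul]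
    refine (hA.sum_abs_vecMul_le hδ (((hA.pow n).sum_vecMul v).trans hv)).trans ?_
    rw [pow_succ', mul_assoc]
    exact mul_le_mul_of_nonneg_left ih hc

theorem tvDist_nonneg {Ω : Type*} [Fintype Ω] (μ ν : Ω → ℝ) : 0 ≤ tvDist μ ν :=
  mul_nonneg (by norm_num) (Finset.sum_nonneg fun _ _ => abs_nonneg _)

theorem tvDist_comm {Ω : Type*} [Fintype Ω] (μ ν : Ω → ℝ) : tvDist μ ν = tvDist ν μ := by
  simp [tvDist, abs_sub_comm]

theorem tvDist_triangle {Ω : Type*} [Fintype Ω] (μ ν ρ : Ω → ℝ) :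
    tvDist μ ρ ≤ tvDist μ ν + tvDist ν ρ := by
  unfold tvDist
  rw [← mul_add, ← Finset.sum_add_distrib]
  gcongr
  exact abs_sub_le _ _ _

theorem IsDist.sum_abs_sub_le_two {Ω : Type*} [Fintype Ω] {μ ν : Ω → ℝ} (hμ : IsDist μ)
    (hν : IsDist ν) : ∑ x, |μ x - ν x| ≤ 2 := by
  calc ∑ x, |μ x - ν x| ≤ ∑ x, (μ x + ν x) := by
        refine Finset.sum_le_sum fun x _ => abs_le.2 ?_
        constructor <;> linarith [hμ.1 x, hν.1 x]
    _ = 2 := by rw [Finset.sum_add_distrib, hμ.2, hν.2]; norm_num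

theorem isDist_single {Ω : Type*} [Fintype Ω] [DecidableEq Ω] (i : Ω) :
    IsDist (Pi.single i (1 : ℝ)) := by
  refine ⟨fun x => ?_, by simp⟩
  by_cases h : x = i <;> simp [h]

theorem dobrushin_nonneg {Ω : Type*} [Fintype Ω] [Nonempty Ω] (M : Matrix Ω Ω ℝ) :
    0 ≤ dobrushin M := by
  obtain ⟨i⟩ := ‹Nonempty Ω›
  exact (tvDist_nonneg (M i) (M i)).trans
    (Finset.le_sup' (fun p : Ω × Ω => tvDist (M p.1) (M p.2)) (Finset.mem_univ (i, i)))

theorem vecMul_pow_eq_self {Ω : Type*} [Fintype Ω] [DecidableEq Ω] {M : Matrix Ω Ω ℝ}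
    {π : Ω → ℝ} (hstat : Matrix.vecMul π M = π) (t : ℕ) : Matrix.vecMul π (M ^ t) = π := by
  induction t with
  | zero => simp
  | succ t ih => rw [pow_succ, ← Matrix.vecMul_vecMul, ih, hstat]

theorem tvDist_vecMul_pow_eq {Ω : Type*} [Fintype Ω] [DecidableEq Ω] {M : Matrix Ω Ω ℝ}
    {π : Ω → ℝ} (hstat : Matrix.vecMul π M = π) (μ : Ω → ℝ) (t : ℕ) :
    tvDist (Matrix.vecMul μ (M ^ t)) π =
      1 / 2 * ∑ x, |Matrix.vecMul (μ - π) (M ^ t) x| := by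
  simp [tvDist, Matrix.sub_vecMul, vecMul_pow_eq_self hstat]

theorem bddAbove_tvDist_vecMul_pow {Ω : Type*} [Fintype Ω] [DecidableEq Ω] {M : Matrix Ω Ω ℝ}
    (hM : IsStochastic M) {π : Ω → ℝ} (hπ : IsDist π) (hstat : Matrix.vecMul π M = π) (t : ℕ) :
    BddAbove (Set.range fun μ : {f : Ω → ℝ // IsDist f} =>
      tvDist (Matrix.vecMul μ.1 (M ^ t)) π) := by
  refine ⟨1, ?_⟩
  rintro _ ⟨⟨μ, hμ⟩, rfl⟩
  have h := (hM.pow t).sum_abs_vecMul_le (hM.pow t).1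
    (v := μ - π) (by simp [hμ.2, hπ.2])
  simp only [tvDist_vecMul_pow_eq hstat]
  have h2 := hμ.sum_abs_sub_le_two hπ
  simp only [Pi.sub_apply, mul_zero, sub_zero, one_mul] at h
  linarith

theorem dobrushin_pow_le_two_mul_distToStat {Ω : Type*} [Fintype Ω] [DecidableEq Ω] [Nonempty Ω]
    {M : Matrix Ω Ω ℝ} (hM : IsStochastic M) {π : Ω → ℝ} (hπ : IsDist π)
    (hstat : Matrix.vecMul π M = π) (t : ℕ) :
    dobrushin (M ^ t) ≤ 2 * distToStat M π t := by
  have row (i : Ω) : tvDist ((M ^ t) i) π ≤ distToStat M π t := by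
    have h := le_ciSup (bddAbove_tvDist_vecMul_pow hM hπ hstat t)
      ⟨Pi.single i 1, isDist_single i⟩
    simp only [Matrix.single_one_vecMul] at h
    exact h
  refine Finset.sup'_le _ _ fun p _ => ?_
  have h := tvDist_triangle ((M ^ t) p.1) π ((M ^ t) p.2)
  rw [tvDist_comm π] at h
  linarith [row p.1, row p.2]

theorem exists_distToStat_lt {Ω : Type*} [Fintype Ω] [DecidableEq Ω] [Nonempty Ω]
    {M : Matrix Ω Ω ℝ} (hM : IsStochastic M) (hErg : IsErgodic M) {π : Ω → ℝ} (hπ : IsDist π)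
    (hstat : Matrix.vecMul π M = π) {ξ : ℝ} (hξ : 0 < ξ) :
    ∃ t : ℕ, 0 < t ∧ distToStat M π t < ξ := by
  obtain ⟨p, hp, hpos⟩ := hErg
  obtain ⟨q, hq⟩ := Finite.exists_min fun q : Ω × Ω => (M ^ p) q.1 q.2
  set δ := (M ^ p) q.1 q.2
  have hδ : ∀ i j, δ ≤ (M ^ p) i j := fun i j => hq (i, j)
  have hc0 : 0 ≤ 1 - Fintype.card Ω * δ := by
    have h : ∑ _j : Ω, δ ≤ ∑ j, (M ^ p) q.1 j := Finset.sum_le_sum fun j _ => hδ q.1 j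
    rw [(hM.pow p).2] at h
    simp only [Finset.sum_const, Finset.card_univ, nsmul_eq_mul] at h
    linarith
  have hc1 : 1 - Fintype.card Ω * δ < 1 :=
    sub_lt_self _ (mul_pos (by exact_mod_cast Fintype.card_pos) (hpos _ _))
  obtain ⟨n, hn⟩ := exists_pow_lt_of_lt_one hξ hc1
  have hn' := (pow_le_pow_of_le_one hc0 hc1.le n.le_succ).trans_lt hn
  refine ⟨p * (n + 1), by positivity, lt_of_le_of_lt ?_ hn'⟩
  have : Nonempty {f : Ω → ℝ // IsDist f} := ⟨⟨π, hπ⟩⟩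
  refine ciSup_le fun ⟨μ, hμ⟩ => ?_
  have h := (hM.pow p).sum_abs_vecMul_pow_le hδ hc0
    (v := μ - π) (by simp [hμ.2, hπ.2]) (n + 1)
  have h2 := mul_le_mul_of_nonneg_left (hμ.sum_abs_sub_le_two hπ) (pow_nonneg hc0 (n + 1))
  rw [← pow_mul] at h
  simp only [tvDist_vecMul_pow_eq hstat]
  simp only [Pi.sub_apply] at h
  simp only [Nat.succ_eq_add_one]
  linarith

theorem one_sub_dobrushin_pow_div_le {Ω : Type*} [Fintype Ω] [DecidableEq Ω] [Nonempty Ω]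
    (M : Matrix Ω Ω ℝ) {t : ℕ} (ht : 0 < t) :
    (1 - dobrushin (M ^ t)) / t ≤ 1 - genCC M := by
  have hb : BddAbove (Set.range fun s : {n : ℕ // 0 < n} =>
      (1 - dobrushin (M ^ (s : ℕ))) / ((s : ℕ) : ℝ)) := by
    refine ⟨1, ?_⟩
    rintro _ ⟨⟨s, hs⟩, rfl⟩
    have h1 : (1 : ℝ) ≤ s := by exact_mod_cast hs
    refine (div_le_one (by linarith)).2 ?_
    linarith [dobrushin_nonneg (M ^ s)]
  have h := le_ciSup hb ⟨t, ht⟩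
  rw [genCC, sub_sub_cancel]
  exact h

/-- lower bound `t_mix(ξ) ≥ (1 − 2ξ)/(1 − κ̃)`. -/
theorem mixTime_lower_bound (M : Matrix Ω Ω ℝ) (hM : IsStochastic M)
    (hErg : IsErgodic M) (π : Ω → ℝ) (hπ : IsDist π)
    (hstat : Matrix.vecMul π M = π) (ξ : ℝ) (hξ : ξ ∈ Set.Ioo (0 : ℝ) (1 / 2)) :
    (1 - 2 * ξ) / (1 - genCC M) ≤ (mixTime M π ξ : ℝ) := by
  obtain ⟨ht, hlt⟩ := Nat.sInf_mem (exists_distToStat_lt hM hErg hπ hstat hξ.1)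
  change 0 < mixTime M π ξ at ht
  change distToStat M π (mixTime M π ξ) < ξ at hlt
  have hκ := dobrushin_pow_le_two_mul_distToStat hM hπ hstat (mixTime M π ξ)
  have hS := one_sub_dobrushin_pow_div_le M ht
  have ht' : (0 : ℝ) < mixTime M π ξ := by exact_mod_cast ht
  rw [div_le_iff₀ ht'] at hS
  have hξ2 := hξ.2
  have hpos : 0 < 1 - genCC M := pos_of_mul_pos_left (by linarith) ht'.le
  rw [div_le_iff₀ hpos]
  linarith
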